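/- arXiv:1312.4581 — 5 statements merged into one kernel-verified Lean document; each statement's English description precedes it below -/
import Mathlib

section
/- Let κ ∈ ℝ with κ ≠ 0, and let L be a real Lie algebra admitting a basis b0, b1, b2 (as a real vector space) satisfying ⁅b2,b1⁆ = b0, ⁅b1,b0⁆ = −κ·b2, and ⁅b2,b0⁆ = −κ·b1. Then L is isomorphic as a Lie algebra to sl(2,ℝ). -/
open LieAlgebra.SpecialLinear

/-- The linear map from `sl(2,ℝ)` sending the standard triple `H, E, F` to
`(2/κ) • b0`, `b1 + b2`, `κ⁻¹ • (b1 - b2)`. -/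
noncomputable def slTwoLinearMap {L : Type*} [LieRing L] [LieAlgebra ℝ L] (κ : ℝ) (b0 b1 b2 : L) :
    sl (Fin 2) ℝ →ₗ[ℝ] L where
  toFun A := (2 / κ * A.val 0 0) • b0 + (A.val 0 1 + A.val 1 0 / κ) • b1 +
    (A.val 0 1 - A.val 1 0 / κ) • b2
  map_add' A B := by
    have h (i j : Fin 2) : (A + B).val i j = A.val i j + B.val i j := rfl
    simp only [h]
    module
  map_smul' c A := by
    have h (i j : Fin 2) : (c • A).val i j = c * A.val i j := rfl
    simp only [h, RingHom.id_apply]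
    module

theorem sl_two_val_one_one (A : sl (Fin 2) ℝ) : A.val 1 1 = -A.val 0 0 := by
  have h : Matrix.trace A.val = 0 := A.property
  rw [Matrix.trace_fin_two] at h
  linarith

/-- The map `slTwoLinearMap` as a morphism of Lie algebras. -/
noncomputable def slTwoLieHom {L : Type*} [LieRing L] [LieAlgebra ℝ L] {κ : ℝ} (hκ : κ ≠ 0)
    {b0 b1 b2 : L} (h1 : ⁅b2, b1⁆ = b0) (h2 : ⁅b1, b0⁆ = -κ • b2) (h3 : ⁅b2, b0⁆ = -κ • b1) :
    sl (Fin 2) ℝ →ₗ⁅ℝ⁆ L where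
  toLinearMap := slTwoLinearMap κ b0 b1 b2
  map_lie' {A B} := by
    have h1' : ⁅b1, b2⁆ = -b0 := by rw [← lie_skew, h1]
    have h2' : ⁅b0, b1⁆ = κ • b2 := by rw [← lie_skew, h2, neg_smul, neg_neg]
    have h3' : ⁅b0, b2⁆ = κ • b1 := by rw [← lie_skew, h3, neg_smul, neg_neg]
    simp only [slTwoLinearMap, AddHom.coe_mk, AddHom.toFun_eq_coe, sl_bracket,
      Matrix.sub_apply, Matrix.mul_apply, Fin.sum_univ_two, sl_two_val_one_one, add_lie, lie_add,
      smul_lie, lie_smul, lie_self, h1, h2, h3, h1', h2', h3']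
    match_scalars <;> field_simp <;> ring

/-- A real Lie algebra with a basis b0, b1, b2 satisfying ⁅b2,b1⁆ = b0, ⁅b1,b0⁆ = −κ·b2,
⁅b2,b0⁆ = −κ·b1 for some κ ≠ 0 is isomorphic to sl(2,ℝ). -/
theorem lieAlgebra_iso_sl2_of_basis (L : Type*) [LieRing L] [LieAlgebra ℝ L]
    (κ : ℝ) (hκ : κ ≠ 0) (b0 b1 b2 : L)
    (hind : LinearIndependent ℝ ![b0, b1, b2])
    (hspan : Submodule.span ℝ (Set.range ![b0, b1, b2]) = ⊤)
    (h1 : ⁅b2, b1⁆ = b0) (h2 : ⁅b1, b0⁆ = -κ • b2) (h3 : ⁅b2, b0⁆ = -κ • b1) :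
    Nonempty (L ≃ₗ⁅ℝ⁆ sl (Fin 2) ℝ) := by
  refine ⟨(LieEquiv.ofBijective (slTwoLieHom hκ h1 h2 h3) ⟨?_, ?_⟩).symm⟩
  · refine (injective_iff_map_eq_zero (slTwoLieHom hκ h1 h2 h3)).2 fun A hA => ?_
    have hz := Fintype.linearIndependent_iff.1 hind
      ![2 / κ * A.val 0 0, A.val 0 1 + A.val 1 0 / κ, A.val 0 1 - A.val 1 0 / κ]
      (by rw [Fin.sum_univ_three]; exact hA)
    have hz0 : 2 / κ * A.val 0 0 = 0 := hz 0
    have hz1 : A.val 0 1 + A.val 1 0 / κ = 0 := hz 1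
    have hz2 : A.val 0 1 - A.val 1 0 / κ = 0 := hz 2
    have h00 : A.val 0 0 = 0 := by simpa [hκ] using hz0
    have h01 : A.val 0 1 = 0 := by linarith
    have h10 : A.val 1 0 = 0 := by simpa [hκ, h01] using hz1
    have h11 : A.val 1 1 = 0 := by rw [sl_two_val_one_one, h00, neg_zero]
    ext i j
    fin_cases i <;> fin_cases j
    exacts [h00, h01, h10, h11]
  · intro x
    obtain ⟨c, rfl⟩ := (Submodule.mem_span_range_iff_exists_fun ℝ).1
      (hspan ▸ Submodule.mem_top : x ∈ Submodule.span ℝ (Set.range ![b0, b1, b2]))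
    refine ⟨⟨!![κ / 2 * c 0, (c 1 + c 2) / 2; κ * (c 1 - c 2) / 2, -(κ / 2 * c 0)], ?_⟩, ?_⟩
    · change Matrix.trace (_ : Matrix (Fin 2) (Fin 2) ℝ) = 0
      simp [Matrix.trace_fin_two]
    · rw [Fin.sum_univ_three]
      change (2 / κ * (κ / 2 * c 0)) • b0 + ((c 1 + c 2) / 2 + κ * (c 1 - c 2) / 2 / κ) • b1 +
        ((c 1 + c 2) / 2 - κ * (c 1 - c 2) / 2 / κ) • b2 = c 0 • b0 + c 1 • b1 + c 2 • b2
      match_scalars <;> field_simp <;> ring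
end

section
/- If, in addition to the frame hypotheses, the vectors X0(p), X1(p), X2(p) are linearly independent in ℝ³ for every p ∈ U, then c01^1(p) + c02^2(p) = 0 for every p ∈ U. -/
/-- Lie bracket of vector fields on (an open subset of) ℝ³:
⁅V,W⁆(p) = DW(p)(V(p)) − DV(p)(W(p)). -/
noncomputable def vlie (V W : (Fin 3 → ℝ) → (Fin 3 → ℝ)) : (Fin 3 → ℝ) → (Fin 3 → ℝ) :=
  fun p => fderiv ℝ W p (V p) - fderiv ℝ V p (W p)

/-- Directional derivative X(f) : p ↦ Df(p)(X(p)). -/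
noncomputable def vder (X : (Fin 3 → ℝ) → (Fin 3 → ℝ)) (f : (Fin 3 → ℝ) → ℝ) :
    (Fin 3 → ℝ) → ℝ :=
  fun p => fderiv ℝ f p (X p)

open VectorField

/-- The Lie bracket with a combination of two vector fields whose coefficients are functions. -/
theorem lieBracket_smul_add_smul {E : Type*} [NormedAddCommGroup E] [NormedSpace ℝ E]
    {W X Y : E → E} {f g : E → ℝ} {x : E}
    (hf : DifferentiableAt ℝ f x) (hg : DifferentiableAt ℝ g x)
    (hX : DifferentiableAt ℝ X x) (hY : DifferentiableAt ℝ Y x) :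
    lieBracket ℝ W (f • X + g • Y) x =
      fderiv ℝ f x (W x) • X x + f x • lieBracket ℝ W X x +
        (fderiv ℝ g x (W x) • Y x + g x • lieBracket ℝ W Y x) := by
  rw [lieBracket_add_right (hf.smul hX) (hg.smul hY),
    show f • X = fun y ↦ f y • X y from rfl, show g • Y = fun y ↦ g y • Y y from rfl,
    lieBracket_smul_right hf hX, lieBracket_smul_right hg hY]

/-- If X0(p), X1(p), X2(p) are linearly independent for every p ∈ U, then
c01^1 + c02^2 = 0 on U. -/
theorem trace_structure_functions_eq_zero
    (U : Set (Fin 3 → ℝ)) (hU : IsOpen U)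
    (X0 X1 X2 : (Fin 3 → ℝ) → (Fin 3 → ℝ))
    (hX0 : ContDiffOn ℝ (⊤ : ℕ∞) X0 U) (hX1 : ContDiffOn ℝ (⊤ : ℕ∞) X1 U) (hX2 : ContDiffOn ℝ (⊤ : ℕ∞) X2 U)
    (c011 c012 c021 c022 c121 c122 : (Fin 3 → ℝ) → ℝ)
    (hc011 : ContDiffOn ℝ (⊤ : ℕ∞) c011 U) (hc012 : ContDiffOn ℝ (⊤ : ℕ∞) c012 U)
    (hc021 : ContDiffOn ℝ (⊤ : ℕ∞) c021 U) (hc022 : ContDiffOn ℝ (⊤ : ℕ∞) c022 U)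
    (hc121 : ContDiffOn ℝ (⊤ : ℕ∞) c121 U) (hc122 : ContDiffOn ℝ (⊤ : ℕ∞) c122 U)
    (hb1 : ∀ p ∈ U, vlie X1 X0 p = c011 p • X1 p + c012 p • X2 p)
    (hb2 : ∀ p ∈ U, vlie X2 X0 p = c021 p • X1 p + c022 p • X2 p)
    (hb3 : ∀ p ∈ U, vlie X2 X1 p = c121 p • X1 p + c122 p • X2 p + X0 p)
    (hli : ∀ p ∈ U, LinearIndependent ℝ ![X0 p, X1 p, X2 p]) :
    ∀ p ∈ U, c011 p + c022 p = 0 := by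
  intro p hp
  have hU' : U ∈ nhds p := hU.mem_nhds hp
  have d {F : Type} [NormedAddCommGroup F] [NormedSpace ℝ F] {f : (Fin 3 → ℝ) → F}
      (hf : ContDiffOn ℝ (⊤ : ℕ∞) f U) : DifferentiableAt ℝ f p :=
    (hf.contDiffAt hU').differentiableAt (by simp)
  have s {X : (Fin 3 → ℝ) → (Fin 3 → ℝ)}
      (hX : ContDiffOn ℝ (⊤ : ℕ∞) X U) : ContDiffAt ℝ 2 X p :=
    (hX.contDiffAt hU').of_le (WithTop.coe_le_coe.2 le_top)
  have e1 : lieBracket ℝ X1 X0 =ᶠ[nhds p] c011 • X1 + c012 • X2 :=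
    Filter.eventually_of_mem hU' hb1
  have e2 : lieBracket ℝ X2 X0 =ᶠ[nhds p] c021 • X1 + c022 • X2 :=
    Filter.eventually_of_mem hU' hb2
  have e3 : lieBracket ℝ X2 X1 =ᶠ[nhds p] c121 • X1 + c122 • X2 + X0 :=
    Filter.eventually_of_mem hU' hb3
  have jacobi := leibniz_identity_lieBracket (𝕜 := ℝ) (n := 2) (by simp) (s hX2) (s hX1) (s hX0)
  rw [Filter.EventuallyEq.rfl.lieBracket_vectorField_eq e1,
    e3.lieBracket_vectorField_eq Filter.EventuallyEq.rfl,
    Filter.EventuallyEq.rfl.lieBracket_vectorField_eq e2,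
    lieBracket_smul_add_smul (d hc011) (d hc012) (d hX1) (d hX2),
    lieBracket_smul_add_smul (d hc021) (d hc022) (d hX1) (d hX2),
    lieBracket_add_left (((d hc121).smul (d hX1)).add ((d hc122).smul (d hX2))) (d hX0),
    lieBracket_swap (V := c121 • X1 + c122 • X2), lieBracket_self,
    lieBracket_smul_add_smul (d hc121) (d hc122) (d hX1) (d hX2),
    lieBracket_swap (V := X0) (W := X1), lieBracket_swap (V := X0) (W := X2),
    lieBracket_swap (V := X1) (W := X2), lieBracket_self, lieBracket_self,
    e1.eq_of_nhds, e2.eq_of_nhds, e3.eq_of_nhds] at jacobi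
  simp only [Pi.add_apply, Pi.smul_apply', Pi.zero_apply] at jacobi
  have key := Fintype.linearIndependent_iff.1 (hli p hp) ![c011 p + c022 p,
    fderiv ℝ c011 p (X2 p) + fderiv ℝ c121 p (X0 p) - fderiv ℝ c021 p (X1 p)
      + c022 p * c121 p - c122 p * c021 p,
    fderiv ℝ c012 p (X2 p) + fderiv ℝ c122 p (X0 p) - fderiv ℝ c022 p (X1 p)
      + c011 p * c122 p - c121 p * c012 p]
  refine key ?_ 0
  simp only [Fin.sum_univ_three, Matrix.cons_val]
  linear_combination (norm := module) jacobi
end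

section
/- Under the frame hypotheses and with the hyperbolically rotated fields Y1, Y2, one has pointwise on U: ⁅Y2,Y1⁆ = d12^1·Y1 + d12^2·Y2 + X0, where d12^1 = (c12^1 − X1(θ))·cosh(θ) − (X2(θ) + c12^2)·sinh(θ) and d12^2 = (X1(θ) − c12^1)·sinh(θ) + (X2(θ) + c12^2)·cosh(θ). -/
/-- The derivative of a combination `f • V + g • W` of vector fields with function coefficients. -/
theorem fderiv_smul_add_smul_apply {f g : (Fin 3 → ℝ) → ℝ} {a b : ℝ} {V W : (Fin 3 → ℝ) → (Fin 3 → ℝ)}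
    {p : Fin 3 → ℝ} {θ' : (Fin 3 → ℝ) →L[ℝ] ℝ}
    (hf : HasFDerivAt f (a • θ') p) (hg : HasFDerivAt g (b • θ') p)
    (hV : DifferentiableAt ℝ V p) (hW : DifferentiableAt ℝ W p) (v : Fin 3 → ℝ) :
    fderiv ℝ (fun q => f q • V q + g q • W q) p v =
      f p • fderiv ℝ V p v + g p • fderiv ℝ W p v + θ' v • (a • V p + b • W p) := by
  have h : HasFDerivAt (fun q => f q • V q + g q • W q) _ p :=
    (hf.smul hV.hasFDerivAt).add (hg.smul hW.hasFDerivAt)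
  rw [h.fderiv]
  simp only [add_apply, smul_apply, ContinuousLinearMap.smulRight_apply, smul_eq_mul]
  module

/-- Bracket of the hyperbolically rotated frame:
⁅Y2,Y1⁆ = d12^1·Y1 + d12^2·Y2 + X0 with the stated formulas for d12^1, d12^2. -/
theorem rotated_frame_bracket_Y2Y1
    (U : Set (Fin 3 → ℝ)) (hU : IsOpen U)
    (X0 X1 X2 : (Fin 3 → ℝ) → (Fin 3 → ℝ))
    (hX0 : ContDiffOn ℝ (⊤ : ℕ∞) X0 U) (hX1 : ContDiffOn ℝ (⊤ : ℕ∞) X1 U) (hX2 : ContDiffOn ℝ (⊤ : ℕ∞) X2 U)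
    (c011 c012 c021 c022 c121 c122 : (Fin 3 → ℝ) → ℝ)
    (hc011 : ContDiffOn ℝ (⊤ : ℕ∞) c011 U) (hc012 : ContDiffOn ℝ (⊤ : ℕ∞) c012 U)
    (hc021 : ContDiffOn ℝ (⊤ : ℕ∞) c021 U) (hc022 : ContDiffOn ℝ (⊤ : ℕ∞) c022 U)
    (hc121 : ContDiffOn ℝ (⊤ : ℕ∞) c121 U) (hc122 : ContDiffOn ℝ (⊤ : ℕ∞) c122 U)
    (hb1 : ∀ p ∈ U, vlie X1 X0 p = c011 p • X1 p + c012 p • X2 p)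
    (hb2 : ∀ p ∈ U, vlie X2 X0 p = c021 p • X1 p + c022 p • X2 p)
    (hb3 : ∀ p ∈ U, vlie X2 X1 p = c121 p • X1 p + c122 p • X2 p + X0 p)
    (θ : (Fin 3 → ℝ) → ℝ) (hθ : ContDiffOn ℝ (⊤ : ℕ∞) θ U)
    (Y1 Y2 : (Fin 3 → ℝ) → (Fin 3 → ℝ))
    (hY1 : Y1 = fun p => Real.cosh (θ p) • X1 p + Real.sinh (θ p) • X2 p)
    (hY2 : Y2 = fun p => Real.sinh (θ p) • X1 p + Real.cosh (θ p) • X2 p)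
    (d121 d122 : (Fin 3 → ℝ) → ℝ)
    (hd121 : d121 = fun p =>
      (c121 p - vder X1 θ p) * Real.cosh (θ p) - (vder X2 θ p + c122 p) * Real.sinh (θ p))
    (hd122 : d122 = fun p =>
      (vder X1 θ p - c121 p) * Real.sinh (θ p) + (vder X2 θ p + c122 p) * Real.cosh (θ p)) :
    ∀ p ∈ U, vlie Y2 Y1 p = d121 p • Y1 p + d122 p • Y2 p + X0 p := by
  intro p hp
  have hUp := hU.mem_nhds hp
  have dX1 : DifferentiableAt ℝ X1 p := (hX1.contDiffAt hUp).differentiableAt (by simp)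
  have dX2 : DifferentiableAt ℝ X2 p := (hX2.contDiffAt hUp).differentiableAt (by simp)
  have dθ := ((hθ.contDiffAt hUp).differentiableAt (by simp)).hasFDerivAt
  have h3 := hb3 p hp
  subst hY1 hY2 hd121 hd122
  simp only [vlie, vder] at h3 ⊢
  rw [fderiv_smul_add_smul_apply dθ.cosh dθ.sinh dX1 dX2,
    fderiv_smul_add_smul_apply dθ.sinh dθ.cosh dX1 dX2]
  simp only [map_add, map_smul, smul_eq_mul]
  have hcs := Real.cosh_sq_sub_sinh_sq (θ p)
  rw [sub_eq_iff_eq_add] at h3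
  rw [h3]
  ext i
  simp only [Pi.add_apply, Pi.sub_apply, Pi.smul_apply, smul_eq_mul]
  linear_combination X0 p i * hcs
end

section
/- (Invariance of κ under hyperbolic rotations.) Under the frame hypotheses, define d12^1 = (c12^1 − X1(θ))·cosh(θ) − (X2(θ) + c12^2)·sinh(θ), d12^2 = (X1(θ) − c12^1)·sinh(θ) + (X2(θ) + c12^2)·cosh(θ), d01^2 = −X0(θ) + c01^2·cosh²(θ) − c02^1·sinh²(θ) + (c02^2 − c01^1)·sinh(θ)·cosh(θ), and d02^1 = −X0(θ) + c02^1·cosh²(θ) − c01^2·sinh²(θ) + (c01^1 − c02^2)·sinh(θ)·cosh(θ). Then, pointwise on U, Y2(d12^1) + Y1(d12^2) − (d12^1)² + (d12^2)² − (1/2)·(d01^2 + d02^1) = X2(c12^1) + X1(c12^2) − (c12^1)² + (c12^2)² − (1/2)·(c01^2 + c02^1). -/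
/-- Iterated directional derivatives along two vector fields commute up to the derivative along
their Lie bracket. -/
theorem vder_vder_sub_vder_vder {V W : (Fin 3 → ℝ) → (Fin 3 → ℝ)} {f : (Fin 3 → ℝ) → ℝ}
    {p : Fin 3 → ℝ} (hV : DifferentiableAt ℝ V p) (hW : DifferentiableAt ℝ W p)
    (hf : ContDiffAt ℝ 2 f p) :
    vder V (vder W f) p - vder W (vder V f) p = fderiv ℝ f p (vlie V W p) := by
  have hf' : DifferentiableAt ℝ (fderiv ℝ f) p :=
    (hf.fderiv_right (m := 1) (by norm_num)).differentiableAt (by norm_num)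
  have hsymm : IsSymmSndFDerivAt ℝ f p := hf.isSymmSndFDerivAt (by simp)
  have hvder {X : (Fin 3 → ℝ) → (Fin 3 → ℝ)} (hX : DifferentiableAt ℝ X p) (v : Fin 3 → ℝ) :
      fderiv ℝ (vder X f) p v = fderiv ℝ f p (fderiv ℝ X p v) + fderiv ℝ (fderiv ℝ f) p v (X p) := by
    unfold vder
    rw [fderiv_clm_apply hf' hX]
    simp
  have hVW : vder V (vder W f) p = fderiv ℝ (vder W f) p (V p) := rfl
  have hWV : vder W (vder V f) p = fderiv ℝ (vder V f) p (W p) := rfl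
  rw [hVW, hWV, hvder hW, hvder hV, hsymm.eq (V p) (W p), vlie, map_sub]
  ring

/-- The directional derivative of a smooth function along a differentiable field is
differentiable. -/
theorem differentiableAt_vder {X : (Fin 3 → ℝ) → (Fin 3 → ℝ)} {f : (Fin 3 → ℝ) → ℝ}
    {p : Fin 3 → ℝ} (hX : DifferentiableAt ℝ X p) (hf : ContDiffAt ℝ 2 f p) :
    DifferentiableAt ℝ (vder X f) p :=
  ((hf.fderiv_right (m := 1) (by norm_num)).differentiableAt (by norm_num)).clm_apply hX

/-- Invariance of κ under hyperbolic rotations of the frame. -/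
theorem kappa_invariant_under_hyperbolic_rotation
    (U : Set (Fin 3 → ℝ)) (hU : IsOpen U)
    (X0 X1 X2 : (Fin 3 → ℝ) → (Fin 3 → ℝ))
    (hX0 : ContDiffOn ℝ (⊤ : ℕ∞) X0 U) (hX1 : ContDiffOn ℝ (⊤ : ℕ∞) X1 U) (hX2 : ContDiffOn ℝ (⊤ : ℕ∞) X2 U)
    (c011 c012 c021 c022 c121 c122 : (Fin 3 → ℝ) → ℝ)
    (hc011 : ContDiffOn ℝ (⊤ : ℕ∞) c011 U) (hc012 : ContDiffOn ℝ (⊤ : ℕ∞) c012 U)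
    (hc021 : ContDiffOn ℝ (⊤ : ℕ∞) c021 U) (hc022 : ContDiffOn ℝ (⊤ : ℕ∞) c022 U)
    (hc121 : ContDiffOn ℝ (⊤ : ℕ∞) c121 U) (hc122 : ContDiffOn ℝ (⊤ : ℕ∞) c122 U)
    (hb1 : ∀ p ∈ U, vlie X1 X0 p = c011 p • X1 p + c012 p • X2 p)
    (hb2 : ∀ p ∈ U, vlie X2 X0 p = c021 p • X1 p + c022 p • X2 p)
    (hb3 : ∀ p ∈ U, vlie X2 X1 p = c121 p • X1 p + c122 p • X2 p + X0 p)
    (θ : (Fin 3 → ℝ) → ℝ) (hθ : ContDiffOn ℝ (⊤ : ℕ∞) θ U)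
    (Y1 Y2 : (Fin 3 → ℝ) → (Fin 3 → ℝ))
    (hY1 : Y1 = fun p => Real.cosh (θ p) • X1 p + Real.sinh (θ p) • X2 p)
    (hY2 : Y2 = fun p => Real.sinh (θ p) • X1 p + Real.cosh (θ p) • X2 p)
    (d121 d122 d012 d021 : (Fin 3 → ℝ) → ℝ)
    (hd121 : d121 = fun p =>
      (c121 p - vder X1 θ p) * Real.cosh (θ p) - (vder X2 θ p + c122 p) * Real.sinh (θ p))
    (hd122 : d122 = fun p =>
      (vder X1 θ p - c121 p) * Real.sinh (θ p) + (vder X2 θ p + c122 p) * Real.cosh (θ p))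
    (hd012 : d012 = fun p =>
      -vder X0 θ p + c012 p * Real.cosh (θ p) ^ 2 - c021 p * Real.sinh (θ p) ^ 2 +
        (c022 p - c011 p) * Real.sinh (θ p) * Real.cosh (θ p))
    (hd021 : d021 = fun p =>
      -vder X0 θ p + c021 p * Real.cosh (θ p) ^ 2 - c012 p * Real.sinh (θ p) ^ 2 +
        (c011 p - c022 p) * Real.sinh (θ p) * Real.cosh (θ p)) :
    ∀ p ∈ U,
      vder Y2 d121 p + vder Y1 d122 p - (d121 p) ^ 2 + (d122 p) ^ 2 -
          (1 / 2) * (d012 p + d021 p) =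
        vder X2 c121 p + vder X1 c122 p - (c121 p) ^ 2 + (c122 p) ^ 2 -
          (1 / 2) * (c012 p + c021 p) := by
  intro p hp
  have hUp : U ∈ nhds p := hU.mem_nhds hp
  have hX1p : DifferentiableAt ℝ X1 p := (hX1.contDiffAt hUp).differentiableAt (by simp)
  have hX2p : DifferentiableAt ℝ X2 p := (hX2.contDiffAt hUp).differentiableAt (by simp)
  have h1 : DifferentiableAt ℝ c121 p := (hc121.contDiffAt hUp).differentiableAt (by simp)
  have h2 : DifferentiableAt ℝ c122 p := (hc122.contDiffAt hUp).differentiableAt (by simp)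
  have hθp : DifferentiableAt ℝ θ p := (hθ.contDiffAt hUp).differentiableAt (by simp)
  have hθ2 : ContDiffAt ℝ 2 θ p := (hθ.contDiffAt hUp).of_le (WithTop.coe_le_coe.2 le_top)
  have ha := differentiableAt_vder hX1p hθ2
  have hb := differentiableAt_vder hX2p hθ2
  have key := vder_vder_sub_vder_vder hX2p hX1p hθ2
  rw [hb3 p hp] at key
  simp only [map_add, map_smul, smul_eq_mul] at key
  have hcosh := hθp.hasFDerivAt.cosh
  have hsinh := hθp.hasFDerivAt.sinh
  have hP := h1.hasFDerivAt.sub ha.hasFDerivAt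
  have hP' := ha.hasFDerivAt.sub h1.hasFDerivAt
  have hQ := hb.hasFDerivAt.add h2.hasFDerivAt
  have hD1 (v : Fin 3 → ℝ) : fderiv ℝ d121 p v =
      (fderiv ℝ c121 p v - fderiv ℝ (vder X1 θ) p v) * Real.cosh (θ p)
        + (c121 p - vder X1 θ p) * (Real.sinh (θ p) * fderiv ℝ θ p v)
        - ((fderiv ℝ (vder X2 θ) p v + fderiv ℝ c122 p v) * Real.sinh (θ p)
        + (vder X2 θ p + c122 p) * (Real.cosh (θ p) * fderiv ℝ θ p v)) := by
    rw [hd121]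
    refine (DFunLike.congr_fun ((hP.mul hcosh).sub (hQ.mul hsinh)).fderiv v).trans ?_
    simp
    ring
  have hD2 (v : Fin 3 → ℝ) : fderiv ℝ d122 p v =
      (fderiv ℝ (vder X1 θ) p v - fderiv ℝ c121 p v) * Real.sinh (θ p)
        + (vder X1 θ p - c121 p) * (Real.cosh (θ p) * fderiv ℝ θ p v)
        + ((fderiv ℝ (vder X2 θ) p v + fderiv ℝ c122 p v) * Real.cosh (θ p)
        + (vder X2 θ p + c122 p) * (Real.sinh (θ p) * fderiv ℝ θ p v)) := by
    rw [hd122]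
    refine (DFunLike.congr_fun ((hP'.mul hsinh).add (hQ.mul hcosh)).fderiv v).trans ?_
    simp
    ring
  have hcs := Real.cosh_sq (θ p)
  have hY (X : (Fin 3 → ℝ) → (Fin 3 → ℝ)) (f : (Fin 3 → ℝ) → ℝ) :
      fderiv ℝ f p (X p) = vder X f p := rfl
  rw [← hY Y2, ← hY Y1, hD1, hD2]
  simp only [hd121, hd122, hd012, hd021, hY1, hY2, map_add, map_smul, smul_eq_mul, hY] at key ⊢
  generalize Real.cosh (θ p) = c at *
  generalize Real.sinh (θ p) = s at *
  grind
end

section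
/- Suppose in addition that the vectors X0(p), X1(p), X2(p) are linearly independent in ℝ³ for every p ∈ U. Then the following identities hold on U: −X1(c) − c·c12^2 + X0(c12^1) = 0 and X2(c) − c·c12^1 + X0(c12^2) = 0. -/
lemma vlie_eq_lieBracket (V W : (Fin 3 → ℝ) → (Fin 3 → ℝ)) (p : Fin 3 → ℝ) :
    vlie V W p = VectorField.lieBracket ℝ V W p := rfl

lemma vder_apply (X : (Fin 3 → ℝ) → (Fin 3 → ℝ)) (f : (Fin 3 → ℝ) → ℝ) (p : Fin 3 → ℝ) :
    vder X f p = fderiv ℝ f p (X p) := rfl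

/-- In the case h̃ = 0, if X0(p), X1(p), X2(p) are linearly independent for every p ∈ U,
then −X1(c) − c·c12^2 + X0(c12^1) = 0 and X2(c) − c·c12^1 + X0(c12^2) = 0 on U. -/
theorem structure_function_identities_htilde_zero
    (U : Set (Fin 3 → ℝ)) (hU : IsOpen U)
    (X0 X1 X2 : (Fin 3 → ℝ) → (Fin 3 → ℝ))
    (hX0 : ContDiffOn ℝ (⊤ : ℕ∞) X0 U) (hX1 : ContDiffOn ℝ (⊤ : ℕ∞) X1 U) (hX2 : ContDiffOn ℝ (⊤ : ℕ∞) X2 U)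
    (c c121 c122 : (Fin 3 → ℝ) → ℝ)
    (hc : ContDiffOn ℝ (⊤ : ℕ∞) c U)
    (hc121 : ContDiffOn ℝ (⊤ : ℕ∞) c121 U) (hc122 : ContDiffOn ℝ (⊤ : ℕ∞) c122 U)
    (hb1 : ∀ p ∈ U, vlie X1 X0 p = c p • X2 p)
    (hb2 : ∀ p ∈ U, vlie X2 X0 p = c p • X1 p)
    (hb3 : ∀ p ∈ U, vlie X2 X1 p = c121 p • X1 p + c122 p • X2 p + X0 p)
    (hli : ∀ p ∈ U, LinearIndependent ℝ ![X0 p, X1 p, X2 p]) :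
    ∀ p ∈ U,
      -vder X1 c p - c p * c122 p + vder X0 c121 p = 0 ∧
      vder X2 c p - c p * c121 p + vder X0 c122 p = 0 := by
  intro p hp
  have hpU : U ∈ nhds p := hU.mem_nhds hp
  have hne : ((⊤ : ℕ∞) : WithTop ℕ∞) ≠ 0 := by simp
  have c0 := hX0.contDiffAt hpU
  have c1 := hX1.contDiffAt hpU
  have c2 := hX2.contDiffAt hpU
  have d0 := c0.differentiableAt hne
  have d1 := c1.differentiableAt hne
  have d2 := c2.differentiableAt hne
  have dc := (hc.contDiffAt hpU).differentiableAt hne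
  have da := (hc121.contDiffAt hpU).differentiableAt hne
  have db := (hc122.contDiffAt hpU).differentiableAt hne
  have e1 : VectorField.lieBracket ℝ X0 X1 =ᶠ[nhds p] fun q => (-c q) • X2 q := by
    filter_upwards [hpU] with q hq
    rw [VectorField.lieBracket_swap, ← vlie_eq_lieBracket, hb1 q hq, neg_smul]
  have e2 : VectorField.lieBracket ℝ X0 X2 =ᶠ[nhds p] fun q => (-c q) • X1 q := by
    filter_upwards [hpU] with q hq
    rw [VectorField.lieBracket_swap, ← vlie_eq_lieBracket, hb2 q hq, neg_smul]
  have e3 : VectorField.lieBracket ℝ X2 X1 =ᶠ[nhds p]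
      fun q => c121 q • X1 q + c122 q • X2 q + X0 q := by
    filter_upwards [hpU] with q hq
    rw [← vlie_eq_lieBracket, hb3 q hq]
  have jacobi := VectorField.leibniz_identity_lieBracket (𝕜 := ℝ) (n := ((⊤ : ℕ∞) : WithTop ℕ∞))
    (by simpa using WithTop.coe_le_coe.mpr (le_top : (2 : ℕ∞) ≤ ⊤)) c0 c2 c1
  rw [Filter.EventuallyEq.rfl.lieBracket_vectorField_eq e3,
    e2.lieBracket_vectorField_eq Filter.EventuallyEq.rfl,
    Filter.EventuallyEq.rfl.lieBracket_vectorField_eq e1] at jacobi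
  have hadd : (fun q => c121 q • X1 q + c122 q • X2 q + X0 q) =
      (fun q => c121 q • X1 q) + (fun q => c122 q • X2 q) + X0 := rfl
  rw [hadd, VectorField.lieBracket_add_right ((da.fun_smul d1).add (db.fun_smul d2)) d0,
    VectorField.lieBracket_add_right (da.fun_smul d1) (db.fun_smul d2),
    VectorField.lieBracket_smul_right da d1, VectorField.lieBracket_smul_right db d2,
    VectorField.lieBracket_smul_left dc.fun_neg d1,
    VectorField.lieBracket_smul_right dc.fun_neg d2, e1.eq_of_nhds, e2.eq_of_nhds] at jacobi
  simp only [VectorField.lieBracket_self, Pi.zero_apply, smul_zero, add_zero, fderiv_fun_neg,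
    _root_.neg_apply, ← vder_apply] at jacobi
  have hcomb := Fintype.linearIndependent_iff.mp (hli p hp)
    ![0, -vder X1 c p - c p * c122 p + vder X0 c121 p,
      vder X2 c p - c p * c121 p + vder X0 c122 p] (by
    rw [← sub_eq_zero] at jacobi
    rw [← jacobi]
    simp only [Fin.sum_univ_three, Matrix.cons_val]
    module)
  exact ⟨hcomb 1, hcomb 2⟩
end
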